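/- arXiv:2301.12752 — 2 statements merged into one kernel-verified Lean document; each statement's English description precedes it below -/
import Mathlib

section
/- Let (Ω, ℱ, ℙ) be a probability space, Σ_A > 0, α > 0, I₀ > 0, C > 0, ζ > 0 and Z > 0. Let X : Ω → ℝ be a random variable whose law is the centered Gaussian measure with variance v = C·∫₀^Z ( ∫₀^{Z₁} exp(−(Z₁ − Z₂)²/ζ²) dZ₂ ) dZ₁, and set 𝓘(Z, ω) = I₀·exp(−Σ_A·Z)·exp(−α·Σ_A·X(ω)). Then the stochastic average is the modified Beer's law 𝔼⟨𝓘(Z)⟩ = I₀·exp(−Σ_A·Z)·exp( (α²·Σ_A²·C·ζ/4)·( √π·Z·erf(Z/ζ) + ζ·exp(−Z²/ζ²) − ζ ) ), where erf(x) = (2/√π)·∫₀^x exp(−t²) dt. -/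
open MeasureTheory ProbabilityTheory

/-- The error function erf(x) = (2/√π)·∫₀^x exp(−t²) dt. -/
noncomputable def erf (x : ℝ) : ℝ :=
  (2 / Real.sqrt Real.pi) * ∫ t in (0 : ℝ)..x, Real.exp (-t ^ 2)

lemma beer_inner (ζ x : ℝ) (hζ : 0 < ζ) :
    (∫ y in (0 : ℝ)..x, Real.exp (-(x - y) ^ 2 / ζ ^ 2)) =
      ζ * ∫ t in (0 : ℝ)..(x / ζ), Real.exp (-t ^ 2) := by
  have h1 := intervalIntegral.integral_comp_sub_left (a := 0) (b := x)
    (fun y : ℝ => Real.exp (-y ^ 2 / ζ ^ 2)) x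
  have h2 := intervalIntegral.integral_comp_div (a := 0) (b := x)
    (fun t : ℝ => Real.exp (-t ^ 2)) hζ.ne'
  simp only [sub_self, sub_zero, zero_div, smul_eq_mul] at h1 h2
  rw [h1, ← h2]
  refine intervalIntegral.integral_congr fun y _ => ?_
  simp only [div_pow, neg_div]

lemma beer_outer (ζ Z : ℝ) (hζ : 0 < ζ) :
    (∫ x in (0 : ℝ)..Z, ζ * ∫ t in (0 : ℝ)..(x / ζ), Real.exp (-t ^ 2)) =
      ζ * (Z * ∫ t in (0 : ℝ)..(Z / ζ), Real.exp (-t ^ 2)) +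
        ζ ^ 2 / 2 * Real.exp (-Z ^ 2 / ζ ^ 2) - ζ ^ 2 / 2 := by
  have hc : Continuous fun t : ℝ => Real.exp (-t ^ 2) := by fun_prop
  have hF : ∀ u : ℝ, HasDerivAt (fun u : ℝ => ∫ t in (0 : ℝ)..u, Real.exp (-t ^ 2))
      (Real.exp (-u ^ 2)) u := fun u =>
    intervalIntegral.integral_hasDerivAt_right (hc.intervalIntegrable _ _)
      (hc.stronglyMeasurableAtFilter _ _) hc.continuousAt
  have hFc : Continuous (fun u : ℝ => ∫ t in (0 : ℝ)..u, Real.exp (-t ^ 2)) :=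
    continuous_iff_continuousAt.2 fun u => (hF u).continuousAt
  have hG : ∀ x : ℝ, HasDerivAt (fun x : ℝ =>
      ζ * (x * ∫ t in (0 : ℝ)..(x / ζ), Real.exp (-t ^ 2)) +
        ζ ^ 2 / 2 * Real.exp (-x ^ 2 / ζ ^ 2))
      (ζ * ∫ t in (0 : ℝ)..(x / ζ), Real.exp (-t ^ 2)) x := by
    intro x
    have a := (hF (x / ζ)).comp x ((hasDerivAt_id x).div_const ζ)
    have b := ((hasDerivAt_id x).mul a).const_mul ζ
    have c := (((((hasDerivAt_id x).pow 2).neg).div_const (ζ ^ 2)).exp).const_mul (ζ ^ 2 / 2)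
    refine (b.add c).congr_deriv ?_
    have e : -(x / ζ) ^ 2 = -x ^ 2 / ζ ^ 2 := by rw [div_pow, neg_div]
    simp [e]
    field_simp
    ring
  have := intervalIntegral.integral_eq_sub_of_hasDerivAt (a := 0) (b := Z)
    (fun x _ => hG x)
    ((continuous_const.mul (hFc.comp (continuous_id.div_const ζ))).intervalIntegrable _ _)
  rw [this]
  simp

/-- Main theorem (modified Beer's law): if X is centered Gaussian with variance
v = C·∫₀^Z ∫₀^{Z₁} exp(−(Z₁−Z₂)²/ζ²) dZ₂ dZ₁ and
𝓘(Z, ω) = I₀·exp(−Σ_A·Z)·exp(−α·Σ_A·X(ω)), then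
𝔼⟨𝓘(Z)⟩ = I₀·exp(−Σ_A·Z)·exp((α²·Σ_A²·C·ζ/4)·(√π·Z·erf(Z/ζ) + ζ·exp(−Z²/ζ²) − ζ)). -/
theorem modified_beer_law
    {Ω : Type*} [MeasurableSpace Ω] (P : Measure Ω) [IsProbabilityMeasure P]
    (SigmaA α I₀ C ζ Z : ℝ) (hSigmaA : 0 < SigmaA) (hα : 0 < α) (hI₀ : 0 < I₀)
    (hC : 0 < C) (hζ : 0 < ζ) (hZ : 0 < Z)
    (v : NNReal)
    (hv : (v : ℝ) = C * ∫ Z₁ in (0 : ℝ)..Z, ∫ Z₂ in (0 : ℝ)..Z₁,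
      Real.exp (-(Z₁ - Z₂) ^ 2 / ζ ^ 2))
    (X : Ω → ℝ) (hX : AEMeasurable X P)
    (hlaw : Measure.map X P = gaussianReal 0 v)
    (𝓘 : Ω → ℝ)
    (h𝓘 : ∀ ω, 𝓘 ω = I₀ * Real.exp (-SigmaA * Z) *
      Real.exp (-α * SigmaA * X ω)) :
    ∫ ω, 𝓘 ω ∂P =
      I₀ * Real.exp (-SigmaA * Z) *
        Real.exp ((α ^ 2 * SigmaA ^ 2 * C * ζ / 4) *
          (Real.sqrt Real.pi * Z * erf (Z / ζ) +
            ζ * Real.exp (-Z ^ 2 / ζ ^ 2) - ζ)) := by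
  have hm := mgf_gaussianReal hlaw (-α * SigmaA)
  have hs : Real.sqrt Real.pi ≠ 0 := (Real.sqrt_pos.2 Real.pi_pos).ne'
  simp_rw [h𝓘]
  rw [integral_const_mul]
  change _ * mgf X P (-α * SigmaA) = _
  rw [hm, hv]
  simp_rw [beer_inner _ _ hζ]
  rw [beer_outer ζ Z hζ, erf]
  congr 2
  field_simp
  ring
end

section
/- Let (Ω, ℱ, ℙ) be a probability space, Σ_A > 0, Σ_S > 0, α > 0, I₀ > 0, C > 0, ζ > 0 and Z > 0, and set Σ_T = Σ_A + Σ_S. Let X : Ω → ℝ be a random variable whose law is the centered Gaussian measure with variance v = C·∫₀^Z ( ∫₀^{Z₁} exp(−(Z₁ − Z₂)²/ζ²) dZ₂ ) dZ₁, and set 𝓘(Z, ω) = I₀·exp(−Σ_T·Z)·exp(−α·Σ_T·X(ω)). Then the stochastic average is the modified Beer–Lambert law 𝔼⟨𝓘(Z)⟩ = I₀·exp(−Σ_T·Z)·exp( (α²·Σ_T²·C·ζ/4)·( √π·Z·erf(Z/ζ) + ζ·exp(−Z²/ζ²) − ζ ) ), where erf(x) = (2/√π)·∫₀^x exp(−t²)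 dt. -/
open MeasureTheory ProbabilityTheory

lemma inner_int (ζ : ℝ) (hζ : 0 < ζ) (z : ℝ) :
    ∫ y in (0 : ℝ)..z, Real.exp (-(z - y) ^ 2 / ζ ^ 2) =
      ζ * ∫ t in (0 : ℝ)..(z / ζ), Real.exp (-t ^ 2) := by
  have h1 := intervalIntegral.integral_comp_sub_left (a := 0) (b := z)
    (fun u : ℝ => Real.exp (-u ^ 2 / ζ ^ 2)) z
  have h2 := intervalIntegral.integral_comp_div (a := 0) (b := z)
    (fun u : ℝ => Real.exp (-u ^ 2)) hζ.ne'
  simp only [sub_self, sub_zero, zero_div, smul_eq_mul] at h1 h2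
  rw [h1, ← h2]
  congr 1
  funext u
  rw [div_pow, neg_div]

lemma outer_int (ζ : ℝ) (hζ : 0 < ζ) (Z : ℝ) :
    ∫ z in (0 : ℝ)..Z, ζ * ∫ t in (0 : ℝ)..(z / ζ), Real.exp (-t ^ 2) =
      ζ * (Z * ∫ t in (0 : ℝ)..(Z / ζ), Real.exp (-t ^ 2)) +
        ζ ^ 2 / 2 * Real.exp (-Z ^ 2 / ζ ^ 2) - ζ ^ 2 / 2 := by
  have hc : Continuous (fun t : ℝ => Real.exp (-t ^ 2)) := by fun_prop
  have hF : ∀ x : ℝ, HasDerivAt (fun x : ℝ => ∫ t in (0 : ℝ)..x, Real.exp (-t ^ 2))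
      (Real.exp (-x ^ 2)) x := fun x =>
    intervalIntegral.integral_hasDerivAt_right (hc.intervalIntegrable _ _)
      hc.aestronglyMeasurable.stronglyMeasurableAtFilter hc.continuousAt
  have hFz : ∀ z : ℝ, HasDerivAt (fun z : ℝ => ∫ t in (0 : ℝ)..(z / ζ), Real.exp (-t ^ 2))
      (Real.exp (-(z / ζ) ^ 2) * (1 / ζ)) z := by
    intro z
    have h0 : HasDerivAt (fun z : ℝ => z / ζ) (1 / ζ) z := (hasDerivAt_id z).div_const ζ
    exact HasDerivAt.comp (h := fun z : ℝ => z / ζ) z (hF (z / ζ)) h0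
  have hG : ∀ z : ℝ, HasDerivAt (fun z : ℝ =>
      ζ * (z * ∫ t in (0 : ℝ)..(z / ζ), Real.exp (-t ^ 2)) +
        ζ ^ 2 / 2 * Real.exp (-z ^ 2 / ζ ^ 2))
      (ζ * ∫ t in (0 : ℝ)..(z / ζ), Real.exp (-t ^ 2)) z := by
    intro z
    have h1 := ((hasDerivAt_id z).mul (hFz z)).const_mul ζ
    have h2 := ((((hasDerivAt_id z).pow 2).neg.div_const (ζ ^ 2)).exp).const_mul (ζ ^ 2 / 2)
    refine (h1.add h2).congr_deriv ?_
    have e : -(z / ζ) ^ 2 = -z ^ 2 / ζ ^ 2 := by rw [div_pow, neg_div]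
    simp only [id, e, Pi.pow_apply, Pi.neg_apply]
    field_simp
    push_cast
    ring
  rw [intervalIntegral.integral_eq_sub_of_hasDerivAt (fun z _ => hG z)]
  · simp
  · refine Continuous.intervalIntegrable ?_ _ _
    exact continuous_const.mul (continuous_iff_continuousAt.2 fun z => (hFz z).continuousAt)

/-- Modified Beer–Lambert law: with Σ_T = Σ_A + Σ_S and X centered Gaussian
with variance v = C·∫₀^Z ∫₀^{Z₁} exp(−(Z₁−Z₂)²/ζ²) dZ₂ dZ₁, the average of
𝓘(Z, ω) = I₀·exp(−Σ_T·Z)·exp(−α·Σ_T·X(ω)) is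
I₀·exp(−Σ_T·Z)·exp((α²·Σ_T²·C·ζ/4)·(√π·Z·erf(Z/ζ) + ζ·exp(−Z²/ζ²) − ζ)). -/
theorem modified_beer_lambert_law
    {Ω : Type*} [MeasurableSpace Ω] (P : Measure Ω) [IsProbabilityMeasure P]
    (SigmaA SigmaS α I₀ C ζ Z : ℝ)
    (hSigmaA : 0 < SigmaA) (hSigmaS : 0 < SigmaS) (hα : 0 < α) (hI₀ : 0 < I₀)
    (hC : 0 < C) (hζ : 0 < ζ) (hZ : 0 < Z)
    (SigmaT : ℝ) (hSigmaT : SigmaT = SigmaA + SigmaS)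
    (v : NNReal)
    (hv : (v : ℝ) = C * ∫ Z₁ in (0 : ℝ)..Z, ∫ Z₂ in (0 : ℝ)..Z₁,
      Real.exp (-(Z₁ - Z₂) ^ 2 / ζ ^ 2))
    (X : Ω → ℝ) (hX : AEMeasurable X P)
    (hlaw : Measure.map X P = gaussianReal 0 v)
    (𝓘 : Ω → ℝ)
    (h𝓘 : ∀ ω, 𝓘 ω = I₀ * Real.exp (-SigmaT * Z) *
      Real.exp (-α * SigmaT * X ω)) :
    ∫ ω, 𝓘 ω ∂P =
      I₀ * Real.exp (-SigmaT * Z) *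
        Real.exp ((α ^ 2 * SigmaT ^ 2 * C * ζ / 4) *
          (Real.sqrt Real.pi * Z * erf (Z / ζ) +
            ζ * Real.exp (-Z ^ 2 / ζ ^ 2) - ζ)) := by
  simp_rw [inner_int ζ hζ] at hv
  rw [outer_int ζ hζ] at hv
  have hm := mgf_gaussianReal hlaw (-α * SigmaT)
  unfold mgf at hm
  simp_rw [h𝓘]
  rw [integral_const_mul, hm, hv, erf]
  congr 2
  have hp : Real.sqrt Real.pi ≠ 0 := (Real.sqrt_pos.2 Real.pi_pos).ne'
  field_simp
  ring
end
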